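/- arXiv:1212.6074 — 2 statements merged into one kernel-verified Lean document; each statement's English description precedes it below -/
import Mathlib

section
/- Let M, N, K be positive integers with K ≥ 2 and N ≥ (K+1)M−1. Then for every integer i with 2 ≤ i ≤ K and every real r with 0 ≤ r ≤ M, one has d^{FC}_{M,N}(r) ≤ d^{FC}_{iM,N}(i·r). -/
/-- The index `l` of the interval of average dimensions per channel use `D`
to which `D` belongs: the smallest `l` with `D ≤ (MN − l(l+1))/(N+M−1−2l)`. -/
noncomputable def lIdx (M N : ℕ) (D : ℝ) : ℕ :=
  sInf {l : ℕ |
    D ≤ ((M : ℝ) * (N : ℝ) - (l : ℝ) * ((l : ℝ) + 1)) /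
        ((N : ℝ) + (M : ℝ) - 1 - 2 * (l : ℝ))}

/-- The upper bound `d^{D}_{M,N}(r)` on the DMT of infinite constellations with
`D` average dimensions per channel use, in a point-to-point channel with `M`
transmit and `N` receive antennas.  It vanishes for `r ≥ D` or `D = 0`, and for
`0 ≤ r < D` it is the straight line `((M−l)(N−l)/(D−l))·(D−r)` where `l = lIdx M N D`
is determined by the interval of `D`. -/
noncomputable def dIC (M N : ℕ) (D r : ℝ) : ℝ :=
  if D ≤ 0 ∨ D ≤ r then 0
  else
    (((M : ℝ) - (lIdx M N D : ℝ)) * ((N : ℝ) - (lIdx M N D : ℝ)) /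
        (D - (lIdx M N D : ℝ))) * (D - r)

/-- The optimal point-to-point DMT `d^{FC}_{M,N}(r)` of finite constellations:
the piecewise linear function through the points `(l, (M−l)(N−l))`. -/
noncomputable def dFC (M N : ℕ) (r : ℝ) : ℝ :=
  ((M : ℝ) - (⌊r⌋ : ℝ)) * ((N : ℝ) - (⌊r⌋ : ℝ))
    + (r - (⌊r⌋ : ℝ)) *
      (((M : ℝ) - (⌊r⌋ : ℝ) - 1) * ((N : ℝ) - (⌊r⌋ : ℝ) - 1)
        - ((M : ℝ) - (⌊r⌋ : ℝ)) * ((N : ℝ) - (⌊r⌋ : ℝ)))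

/-- The optimal symmetric multiple-access DMT `d^{FC}_{K,M,N}(r)` of finite
constellations: it equals `d^{FC}_{M,N}(r)` for `r ≤ min(N/(K+1), M)` and
`d^{FC}_{KM,N}(K·r)` afterwards. -/
noncomputable def dFCmac (K M N : ℕ) (r : ℝ) : ℝ :=
  if r ≤ min ((N : ℝ) / ((K : ℝ) + 1)) (M : ℝ) then dFC M N r
  else dFC (K * M) N ((K : ℝ) * r)

/-- Closed form of `dFC`. -/
theorem dFC_eq_fract (M N : ℕ) (r : ℝ) :
    dFC M N r = ((M : ℝ) - r) * ((N : ℝ) - r) + (r - ⌊r⌋) * (1 - (r - ⌊r⌋)) := by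
  unfold dFC
  ring

theorem fract_parabola_ge (x : ℝ) (n : ℤ) :
    (x - n) * (n + 1 - x) ≤ (x - ⌊x⌋) * (1 - (x - ⌊x⌋)) := by
  have h1 := Int.floor_le x
  have h2 := Int.lt_floor_add_one x
  rcases lt_trichotomy n ⌊x⌋ with h | h | h
  · have h3 : (n : ℝ) + 1 ≤ ⌊x⌋ := by exact_mod_cast h
    nlinarith
  · subst h
    apply le_of_eq
    ring
  · have h3 : (⌊x⌋ : ℝ) + 1 ≤ n := by exact_mod_cast h
    nlinarith

theorem stmt1 (M N K : ℕ) (hM : 0 < M) (hN : 0 < N) (hK : 2 ≤ K)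
    (hNK : (K + 1) * M - 1 ≤ N) (i : ℕ) (hi2 : 2 ≤ i) (hiK : i ≤ K)
    (r : ℝ) (hr0 : 0 ≤ r) (hrM : r ≤ (M : ℝ)) :
    dFC M N r ≤ dFC (i * M) N ((i : ℝ) * r) := by
  have hN1 : ((i : ℝ) + 1) * M - 1 ≤ N := by
    have h : (i + 1) * M ≤ N + 1 := by
      have := Nat.mul_le_mul_right M (Nat.add_le_add_right hiK 1)
      omega
    have h' : ((i : ℝ) + 1) * M ≤ N + 1 := by exact_mod_cast h
    linarith
  have hi : (2 : ℝ) ≤ i := by exact_mod_cast hi2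
  rw [dFC_eq_fract, dFC_eq_fract]
  push_cast
  have hf0 := Int.floor_le r
  have hf1 := Int.lt_floor_add_one r
  have hkey : ((i : ℝ) - 1) * ((M - r) * ((i + 1) * (M - r) - 1))
      ≤ ((i : ℝ) - 1) * ((M - r) * (N - (i + 1) * r)) := by
    apply mul_le_mul_of_nonneg_left _ (by linarith)
    apply mul_le_mul_of_nonneg_left _ (by linarith)
    linarith
  by_cases hs : (M : ℝ) - r ≤ 1
  · have hg := fract_parabola_ge ((i : ℝ) * r) ((i : ℤ) * M - 1)
    push_cast at hg
    have hf : (r - ⌊r⌋) * (1 - (r - ⌊r⌋)) = (M - r) * (1 - (M - r)) := by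
      rcases hrM.eq_or_lt with h | h
      · rw [h]
        simp
      · have : ⌊r⌋ = (M : ℤ) - 1 := by
          rw [Int.floor_eq_iff]
          push_cast
          constructor <;> linarith
        rw [this]
        push_cast
        ring
    rw [hf]
    nlinarith
  · push Not at hs
    have hg : 0 ≤ ((i : ℝ) * r - ⌊(i : ℝ) * r⌋) * (1 - ((i : ℝ) * r - ⌊(i : ℝ) * r⌋)) := by
      have := Int.floor_le ((i : ℝ) * r)
      have := Int.lt_floor_add_one ((i : ℝ) * r)
      apply mul_nonneg <;> linarith
    have hf : (r - ⌊r⌋) * (1 - (r - ⌊r⌋)) ≤ 1 := by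
      nlinarith [sq_nonneg (r - ⌊r⌋ - 1 / 2)]
    have h1 : (1 : ℝ) ≤ (i + 1) * (M - r) - 1 := by nlinarith
    have h2 : (1 : ℝ) ≤ (M - r) * ((i + 1) * (M - r) - 1) := by nlinarith
    have h3 : (1 : ℝ) ≤ ((i : ℝ) - 1) * ((M - r) * ((i + 1) * (M - r) - 1)) := by nlinarith
    linarith
end

section
/- Let K ≥ 2, M ≥ 2 be integers, let l be an integer with 0 ≤ l ≤ 2M−3, set N = (K−1)M+1+l and L = min(N,KM). Set c_l = ⌊l/2⌋(⌊l/2⌋+1) + 2(⌊l/2⌋+1)(l/2 − ⌊l/2⌋) and d*(r) = MN − c_l − (N+M−1−l)·r. For real r with 0 ≤ r ≤ L/K, let S(r) denote the supremum over tuples (D_1,…,D_K) of reals with 0 ≤ D_i ≤ M for each i and D_1+⋯+D_K ≤ L, of the minimum over nonempty subsets A ⊆ {1,…,K} of d^{D_A}_{|A|M,N}(|A|·r), where D_A = Σ_{a∈A} D_a. Then S(r) = d^{FC}_{M,N}(r) for 0 ≤ r ≤ ⌊l/2⌋+1, S(r) = d*(r) for ⌊l/2⌋+1 ≤ r ≤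 ((K−1)M+⌊(l+1)/2⌋)/K, and S(r) = d^{FC}_{KM,N}(K·r) for ((K−1)M+⌊(l+1)/2⌋)/K ≤ r ≤ L/K. -/
lemma int_mul_succ_nonneg (z : ℤ) : (0 : ℝ) ≤ (z : ℝ) * ((z : ℝ) + 1) := by
  have h : (0 : ℤ) ≤ z * (z + 1) := by
    rcases le_or_gt 0 z with h | h
    · positivity
    · nlinarith
  exact_mod_cast h

/-- Key characterization of `dIC`: it is the supporting line of the convex function through `(D,0)`. -/
lemma dIC_char (M N : ℕ) (hM : 1 ≤ M) (hN : 1 ≤ N) (D : ℝ) (hD : 0 < D)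
    (hDM : D ≤ M) (hDN : D ≤ N) :
    ∃ σ : ℝ, 0 ≤ σ ∧ (∀ r, r < D → dIC M N D r = σ * (D - r)) ∧
      (∀ j : ℕ, σ * (D - j) ≤ ((M : ℝ) - j) * ((N : ℝ) - j)) ∧
      (∃ j : ℕ, (j : ℝ) < D ∧ σ * (D - j) = ((M : ℝ) - j) * ((N : ℝ) - j)) := by
  set T : Set ℕ := {l : ℕ |
    D ≤ ((M : ℝ) * (N : ℝ) - (l : ℝ) * ((l : ℝ) + 1)) /
        ((N : ℝ) + (M : ℝ) - 1 - 2 * (l : ℝ))} with hT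
  have hmem : min M N - 1 ∈ T := by
    rw [hT, Set.mem_ofPred_eq]
    rcases le_total M N with h | h
    · rw [min_eq_left h]
      have hc : ((M - 1 : ℕ) : ℝ) = (M : ℝ) - 1 := by push_cast [hM]; ring
      have h' : (M : ℝ) ≤ N := by exact_mod_cast h
      rw [hc, le_div_iff₀ (by linarith)]
      nlinarith
    · rw [min_eq_right h]
      have hc : ((N - 1 : ℕ) : ℝ) = (N : ℝ) - 1 := by push_cast [hN]; ring
      have h' : (N : ℝ) ≤ M := by exact_mod_cast h
      rw [hc, le_div_iff₀ (by linarith)]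
      nlinarith
  have hin : lIdx M N D ∈ T := Nat.sInf_mem ⟨_, hmem⟩
  have hle : lIdx M N D ≤ min M N - 1 := Nat.sInf_le hmem
  have hnot : ∀ m, m < lIdx M N D → m ∉ T := fun m hm => Nat.notMem_of_lt_sInf hm
  generalize hlam : lIdx M N D = lam at *
  have h1 : lam + 1 ≤ M := by omega
  have h2 : lam + 1 ≤ N := by omega
  have h1' : (lam : ℝ) + 1 ≤ M := by exact_mod_cast h1
  have h2' : (lam : ℝ) + 1 ≤ N := by exact_mod_cast h2
  rw [hT, Set.mem_ofPred_eq, le_div_iff₀ (by linarith)] at hin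
  have hprev : 1 ≤ lam → ((M : ℝ) - lam) * ((N : ℝ) - lam) < (D - lam) * (N + M + 1 - 2 * lam) := by
    intro hl
    have h3 := hnot (lam - 1) (by omega)
    have hc : ((lam - 1 : ℕ) : ℝ) = (lam : ℝ) - 1 := by push_cast [hl]; ring
    rw [hT, Set.mem_ofPred_eq, hc, not_le, div_lt_iff₀ (by linarith)] at h3
    nlinarith
  have hab : 0 < ((M : ℝ) - lam) * ((N : ℝ) - lam) := by
    apply mul_pos <;> linarith
  have hδ : 0 < D - lam := by
    rcases Nat.eq_zero_or_pos lam with h | h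
    · rw [h]; simpa using hD
    · have h3 := hprev h
      have h4 : (0 : ℝ) < N + M + 1 - 2 * lam := by linarith
      by_contra hcon
      push Not at hcon
      nlinarith
  have hσ : ((M : ℝ) - lam) * ((N : ℝ) - lam) / (D - lam) * (D - lam)
      = ((M : ℝ) - lam) * ((N : ℝ) - lam) := div_mul_cancel₀ _ hδ.ne'
  have hσ0 : 0 ≤ ((M : ℝ) - lam) * ((N : ℝ) - lam) / (D - lam) := by positivity
  have hσlow : (N : ℝ) + M - 1 - 2 * lam ≤ ((M : ℝ) - lam) * ((N : ℝ) - lam) / (D - lam) := by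
    rw [le_div_iff₀ hδ]; nlinarith
  have hσup : 1 ≤ lam → ((M : ℝ) - lam) * ((N : ℝ) - lam) / (D - lam) ≤ N + M + 1 - 2 * lam := by
    intro hl
    rw [div_le_iff₀ hδ]; nlinarith [hprev hl]
  refine ⟨((M : ℝ) - lam) * ((N : ℝ) - lam) / (D - lam), hσ0, ?_, ?_, lam, by linarith, hσ⟩
  · intro r hr
    unfold dIC
    rw [if_neg (by push Not; exact ⟨hD, hr⟩), hlam]
  · intro j
    generalize ((M : ℝ) - lam) * ((N : ℝ) - lam) / (D - lam) = σ at *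
    rcases lt_trichotomy j lam with h | h | h
    · have h5 : (j : ℝ) + 1 ≤ lam := by exact_mod_cast h
      have h6 := hσup (by omega)
      nlinarith [mul_nonneg (by linarith : (0 : ℝ) ≤ lam - j)
        (by linarith : (0 : ℝ) ≤ (M - lam) + (N - lam) + (lam - j) - σ)]
    · rw [h]; exact hσ.le
    · have h5 : (lam : ℝ) + 1 ≤ j := by exact_mod_cast h
      nlinarith [mul_nonneg (by linarith : (0 : ℝ) ≤ j - lam)
        (by linarith : (0 : ℝ) ≤ σ - ((M - lam) + (N - lam) + (lam - j)))]

lemma dFC_line (M N p : ℕ) (r : ℝ) (h1 : (p : ℝ) ≤ r) (h2 : r ≤ p + 1) :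
    dFC M N r = (M : ℝ) * N - p * (p + 1) - (N + M - 1 - 2 * p) * r := by
  rcases h2.lt_or_eq with h | h
  · have hf : ⌊r⌋ = (p : ℤ) := by
      rw [Int.floor_eq_iff]; exact ⟨by exact_mod_cast h1, by exact_mod_cast h⟩
    unfold dFC
    rw [hf]; push_cast; ring
  · have hf : ⌊r⌋ = (p : ℤ) + 1 := by
      rw [Int.floor_eq_iff]; push_cast; constructor <;> linarith
    unfold dFC
    rw [hf]; subst h; push_cast; ring

lemma dFC_nat (M N p : ℕ) : dFC M N p = ((M : ℝ) - p) * (N - p) := by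
  rw [dFC_line M N p p le_rfl (by linarith)]; ring

lemma dFC_nonneg (M N : ℕ) (r : ℝ) (h0 : 0 ≤ r) (hM : r ≤ M) (hN : r ≤ N) : 0 ≤ dFC M N r := by
  have hp := Nat.floor_le h0
  have hp2 := Nat.lt_floor_add_one r
  generalize ⌊r⌋₊ = p at *
  rcases hp.eq_or_lt with h | h
  · rw [← h, dFC_nat]; apply mul_nonneg <;> linarith
  · rw [dFC_line M N p r hp hp2.le]
    have hM1 : (p : ℝ) + 1 ≤ M := by
      have : (p : ℝ) < M := by linarith
      exact_mod_cast this
    have hN1 : (p : ℝ) + 1 ≤ N := by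
      have : (p : ℝ) < N := by linarith
      exact_mod_cast this
    have a1 : 0 ≤ ((M : ℝ) - p - 1) * ((N : ℝ) - p - 1) := by apply mul_nonneg <;> linarith
    have a2 : 0 ≤ ((M : ℝ) - p) * ((N : ℝ) - p) := by apply mul_nonneg <;> linarith
    have := mul_nonneg a1 (by linarith : 0 ≤ r - p)
    have := mul_nonneg a2 (by linarith : 0 ≤ p + 1 - r)
    nlinarith

lemma dIC_le_dFC (M N : ℕ) (hM : 1 ≤ M) (hN : 1 ≤ N) (D r : ℝ)
    (hDM : D ≤ M) (hDN : D ≤ N) (h0 : 0 ≤ r) (hrM : r ≤ M) (hrN : r ≤ N) :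
    dIC M N D r ≤ dFC M N r := by
  rcases le_or_gt D r with h | h
  · rw [dIC, if_pos (Or.inr h)]; exact dFC_nonneg M N r h0 hrM hrN
  · obtain ⟨σ, hσ0, hσ, hup, -⟩ := dIC_char M N hM hN D (by linarith) hDM hDN
    rw [hσ r h]
    have hp := Nat.floor_le h0
    have hp2 := Nat.lt_floor_add_one r
    generalize ⌊r⌋₊ = p at *
    rw [dFC_line M N p r hp hp2.le]
    have a1 := mul_le_mul_of_nonneg_right (hup p) (by linarith : 0 ≤ p + 1 - r)
    have a2 := mul_le_mul_of_nonneg_right (hup (p + 1)) (by linarith : 0 ≤ r - p)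
    push_cast at a2
    nlinarith

/-- Achievability with equal dimensions for one subset size. -/
lemma dIC_ge (M N k : ℕ) (hM : 1 ≤ M) (hN : 1 ≤ N) (hk : 1 ≤ k) (D r s : ℝ) (hs : 0 ≤ s)
    (h0 : 0 ≤ r) (hDM : D ≤ M) (hDN : k * D ≤ N)
    (H : ∀ j : ℕ, j ≤ k * M →
      s * (k * D - j) ≤ k * (((k : ℝ) * M - j) * ((N : ℝ) - j))) :
    s * (D - r) ≤ dIC (k * M) N (k * D) (k * r) := by
  have hk' : (1 : ℝ) ≤ k := by exact_mod_cast hk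
  rcases le_or_gt D r with h | h
  · rw [dIC, if_pos (Or.inr (by gcongr))]
    nlinarith
  · have hkD : (k : ℝ) * D ≤ ((k * M : ℕ) : ℝ) := by push_cast; gcongr
    obtain ⟨σ, hσ0, hσ, -, j, hj, hje⟩ := dIC_char (k * M) N (Nat.mul_pos hk hM) hN (k * D)
      (by apply mul_pos <;> linarith) hkD hDN
    rw [hσ _ (by gcongr)]
    have hj' : j ≤ k * M := by
      have : (j : ℝ) ≤ ((k * M : ℕ) : ℝ) := by linarith
      exact_mod_cast this
    have h1 := H j hj'
    push_cast at hje
    rw [← hje, ← mul_assoc] at h1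
    have h2 : s ≤ k * σ := le_of_mul_le_mul_right h1 (by linarith)
    nlinarith

lemma S_eq (K M N L : ℕ) (r U : ℝ)
    (hub : ∀ D : Fin K → ℝ, (∀ i, 0 ≤ D i ∧ D i ≤ (M : ℝ)) → (∑ i, D i) ≤ (L : ℝ) →
      ∃ A : Finset (Fin K), A.Nonempty ∧ dIC (A.card * M) N (∑ a ∈ A, D a) ((A.card : ℝ) * r) ≤ U)
    (hach : ∃ D : Fin K → ℝ, (∀ i, 0 ≤ D i ∧ D i ≤ (M : ℝ)) ∧ (∑ i, D i) ≤ (L : ℝ) ∧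
      ∀ A : Finset (Fin K), A.Nonempty → U ≤ dIC (A.card * M) N (∑ a ∈ A, D a) ((A.card : ℝ) * r)) :
    sSup {x : ℝ | ∃ D : Fin K → ℝ,
        (∀ i, 0 ≤ D i ∧ D i ≤ (M : ℝ)) ∧ (∑ i, D i) ≤ (L : ℝ) ∧
        x = sInf {y : ℝ | ∃ A : Finset (Fin K), A.Nonempty ∧
              y = dIC (A.card * M) N (∑ a ∈ A, D a) ((A.card : ℝ) * r)}} = U := by
  have hbd : ∀ D : Fin K → ℝ, BddBelow {y : ℝ | ∃ A : Finset (Fin K), A.Nonempty ∧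
              y = dIC (A.card * M) N (∑ a ∈ A, D a) ((A.card : ℝ) * r)} := by
    intro D
    apply Set.Finite.bddBelow
    apply (Set.finite_range (fun A : Finset (Fin K) =>
      dIC (A.card * M) N (∑ a ∈ A, D a) ((A.card : ℝ) * r))).subset
    rintro y ⟨A, -, rfl⟩
    exact ⟨A, rfl⟩
  have hle : ∀ x ∈ {x : ℝ | ∃ D : Fin K → ℝ,
        (∀ i, 0 ≤ D i ∧ D i ≤ (M : ℝ)) ∧ (∑ i, D i) ≤ (L : ℝ) ∧
        x = sInf {y : ℝ | ∃ A : Finset (Fin K), A.Nonempty ∧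
              y = dIC (A.card * M) N (∑ a ∈ A, D a) ((A.card : ℝ) * r)}}, x ≤ U := by
    rintro x ⟨D, h1, h2, rfl⟩
    obtain ⟨A, hA, hAU⟩ := hub D h1 h2
    exact (csInf_le (hbd D) ⟨A, hA, rfl⟩).trans hAU
  obtain ⟨D, h1, h2, h3⟩ := hach
  apply le_antisymm
  · exact csSup_le ⟨_, D, h1, h2, rfl⟩ hle
  · refine le_trans ?_ (le_csSup ⟨U, hle⟩ ⟨D, h1, h2, rfl⟩)
    obtain ⟨A, hA, -⟩ := hub D h1 h2
    refine le_csInf ⟨dIC (A.card * M) N (∑ a ∈ A, D a) ((A.card : ℝ) * r), A, hA, rfl⟩ ?_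
    rintro y ⟨B, hB, rfl⟩
    exact h3 B hB

/-- Achievability with equal dimensions. -/
lemma ach (K M N : ℕ) (hK : 1 ≤ K) (hM : 1 ≤ M) (hN : 1 ≤ N) (D r s U : ℝ) (hs : 0 < s)
    (hD : 0 ≤ D) (h0 : 0 ≤ r) (hU : U = s * (D - r))
    (H : ∀ k : ℕ, 1 ≤ k → k ≤ K → ∀ j : ℕ, j ≤ k * M →
      s * (k * D - j) ≤ k * (((k : ℝ) * M - j) * ((N : ℝ) - j))) :
    ∃ D : Fin K → ℝ, (∀ i, 0 ≤ D i ∧ D i ≤ (M : ℝ)) ∧ (∑ i, D i) ≤ ((min N (K * M) : ℕ) : ℝ) ∧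
      ∀ A : Finset (Fin K), A.Nonempty →
        U ≤ dIC (A.card * M) N (∑ a ∈ A, D a) ((A.card : ℝ) * r) := by
  have hK' : (1 : ℝ) ≤ K := by exact_mod_cast hK
  have hDM : D ≤ M := by
    have h := H 1 le_rfl hK M (by omega)
    push_cast at h
    by_contra hc
    push Not at hc
    have := mul_pos hs (by linarith : 0 < 1 * D - M)
    nlinarith
  have hKM : (K : ℝ) * D ≤ K * M := by gcongr
  have hKN : (K : ℝ) * D ≤ N := by
    rcases le_total N (K * M) with hc | hc
    · have h := H K hK le_rfl N hc
      by_contra hc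
      push Not at hc
      have := mul_pos hs (by linarith : 0 < K * D - N)
      nlinarith
    · have : ((K * M : ℕ) : ℝ) ≤ N := by exact_mod_cast hc
      push_cast at this
      linarith
  refine ⟨fun _ => D, fun _ => ⟨hD, hDM⟩, ?_, ?_⟩
  · simp only [Finset.sum_const, Finset.card_univ, Fintype.card_fin, nsmul_eq_mul]
    push_cast
    exact le_min hKN hKM
  · intro A hA
    have hc1 : 1 ≤ A.card := hA.card_pos
    have hc2 : A.card ≤ K := by simpa using Finset.card_le_univ A
    simp only [Finset.sum_const, nsmul_eq_mul]
    rw [hU]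
    have hc2' : (A.card : ℝ) ≤ K := by exact_mod_cast hc2
    have : (A.card : ℝ) * D ≤ K * D := by gcongr
    exact dIC_ge M N A.card hM hN hc1 D r s hs.le h0 hDM (by linarith) (H _ hc1 hc2)

lemma ub_single (K M N : ℕ) (i : Fin K) (D : Fin K → ℝ) (r U : ℝ)
    (h : dIC M N (D i) r ≤ U) :
    ∃ A : Finset (Fin K), A.Nonempty ∧
      dIC (A.card * M) N (∑ a ∈ A, D a) ((A.card : ℝ) * r) ≤ U := by
  refine ⟨{i}, by simp, ?_⟩
  simpa using h

lemma ub_univ (K M N : ℕ) (hK : 1 ≤ K) (D : Fin K → ℝ) (r U : ℝ)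
    (h : dIC (K * M) N (∑ i, D i) (K * r) ≤ U) :
    ∃ A : Finset (Fin K), A.Nonempty ∧
      dIC (A.card * M) N (∑ a ∈ A, D a) ((A.card : ℝ) * r) ≤ U := by
  refine ⟨Finset.univ, ⟨⟨0, hK⟩, by simp⟩, ?_⟩
  simpa using h

/-- Case (a): tangent to a segment of the single-user curve. -/
lemma H_a (K M N l p : ℕ) (hN : (N : ℝ) = ((K : ℝ) - 1) * M + 1 + l) (hp : 2 * p ≤ l)
    (D s : ℝ) (hs : s = N + M - 1 - 2 * p) (hD : s * D = M * N - p * (p + 1)) :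
    ∀ k : ℕ, 1 ≤ k → k ≤ K → ∀ j : ℕ, j ≤ k * M →
      s * (k * D - j) ≤ k * (((k : ℝ) * M - j) * ((N : ℝ) - j)) := by
  intro k hk1 hkK j hj
  have hk1' : (0 : ℝ) ≤ (k : ℝ) - 1 := by
    have : (1 : ℝ) ≤ k := by exact_mod_cast hk1
    linarith
  have hkK' : (0 : ℝ) ≤ (K : ℝ) - k := by
    have : (k : ℝ) ≤ K := by exact_mod_cast hkK
    linarith
  have hy : (0 : ℝ) ≤ (k : ℝ) * M - j := by
    have : (j : ℝ) ≤ ((k * M : ℕ) : ℝ) := by exact_mod_cast hj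
    push_cast at this; linarith
  have hg : (0 : ℝ) ≤ (l : ℝ) - 2 * p := by
    have : ((2 * p : ℕ) : ℝ) ≤ l := by exact_mod_cast hp
    push_cast at this; linarith
  have h1 := int_mul_succ_nonneg ((k : ℤ) * M - j - (M - p))
  push_cast at h1
  have h2 : (0 : ℝ) ≤ ((k : ℝ) * M - j) * ((l - 2 * p) * (k - 1) + M * (k - 1) * (K - k)) := by
    positivity
  have h3 : (0 : ℝ) ≤ k * (((k : ℝ) * M - j - (M - p)) * ((k : ℝ) * M - j - (M - p) + 1)) := by
    positivity
  have key : k * (((k : ℝ) * M - j) * ((N : ℝ) - j)) - s * (k * D - j)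
      = k * (((k : ℝ) * M - j - (M - p)) * ((k : ℝ) * M - j - (M - p) + 1))
        + ((k : ℝ) * M - j) * ((l - 2 * p) * (k - 1) + M * (k - 1) * (K - k)) := by
    have e : s * (k * D - j) = k * (M * N - p * (p + 1)) - s * j := by rw [← hD]; ring
    rw [e, hs, hN]; ring
  linarith

/-- Case (b): odd `l`, the middle line. -/
lemma H_b (K M N l b : ℕ) (hN : (N : ℝ) = ((K : ℝ) - 1) * M + 1 + l) (hb : l = 2 * b + 1)
    (D s : ℝ) (hs : s = K * M) (hD : s * D = M * N - (b + 1) ^ 2) :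
    ∀ k : ℕ, 1 ≤ k → k ≤ K → ∀ j : ℕ, j ≤ k * M →
      s * (k * D - j) ≤ k * (((k : ℝ) * M - j) * ((N : ℝ) - j)) := by
  intro k hk1 hkK j hj
  have hk1' : (0 : ℝ) ≤ (k : ℝ) - 1 := by
    have : (1 : ℝ) ≤ k := by exact_mod_cast hk1
    linarith
  have hkK' : (0 : ℝ) ≤ (K : ℝ) - k := by
    have : (k : ℝ) ≤ K := by exact_mod_cast hkK
    linarith
  have hy : (0 : ℝ) ≤ (k : ℝ) * M - j := by
    have : (j : ℝ) ≤ ((k * M : ℕ) : ℝ) := by exact_mod_cast hj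
    push_cast at this; linarith
  have h2 : (0 : ℝ) ≤ ((k : ℝ) * M - j) * (M * (k - 1) * (K - k)) := by
    positivity
  have h3 : (0 : ℝ) ≤ k * ((k : ℝ) * M - j - (M - b - 1)) ^ 2 := by
    positivity
  have key : k * (((k : ℝ) * M - j) * ((N : ℝ) - j)) - s * (k * D - j)
      = k * ((k : ℝ) * M - j - (M - b - 1)) ^ 2
        + ((k : ℝ) * M - j) * (M * (k - 1) * (K - k)) := by
    have e : s * (k * D - j) = k * (M * N - (b + 1) ^ 2) - s * j := by rw [← hD]; ring
    rw [e, hs, hN, hb]; push_cast; ring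
  linarith

/-- Case (c): tangent to a segment of the `K`-user curve. -/
lemma H_c (K M N l m p : ℕ) (hN : (N : ℝ) = ((K : ℝ) - 1) * M + 1 + l) (hm : l ≤ 2 * m)
    (hp : (p : ℝ) = ((K : ℝ) - 1) * M + m)
    (D s : ℝ) (hs : s = K * (N + K * M - 1 - 2 * p)) (hD : s * D = K * M * N - p * (p + 1)) :
    ∀ k : ℕ, 1 ≤ k → k ≤ K → ∀ j : ℕ, j ≤ k * M →
      s * (k * D - j) ≤ k * (((k : ℝ) * M - j) * ((N : ℝ) - j)) := by
  intro k hk1 hkK j hj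
  have hk1' : (0 : ℝ) ≤ (k : ℝ) - 1 := by
    have : (1 : ℝ) ≤ k := by exact_mod_cast hk1
    linarith
  have hkK' : (0 : ℝ) ≤ (K : ℝ) - k := by
    have : (k : ℝ) ≤ K := by exact_mod_cast hkK
    linarith
  have hy : (0 : ℝ) ≤ (k : ℝ) * M - j := by
    have : (j : ℝ) ≤ ((k * M : ℕ) : ℝ) := by exact_mod_cast hj
    push_cast at this; linarith
  have hg : (0 : ℝ) ≤ 2 * (m : ℝ) - l := by
    have : (l : ℝ) ≤ ((2 * m : ℕ) : ℝ) := by exact_mod_cast hm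
    push_cast at this; linarith
  have h1 := int_mul_succ_nonneg ((k : ℤ) * M - j - (M - m))
  push_cast at h1
  have h2 : (0 : ℝ) ≤ ((k : ℝ) * M - j) * (M * (k - 1) * (K - k) + (2 * m - l) * (K - k)) := by
    positivity
  have h3 : (0 : ℝ) ≤ k * (((k : ℝ) * M - j - (M - m)) * ((k : ℝ) * M - j - (M - m) + 1)) := by
    positivity
  have key : k * (((k : ℝ) * M - j) * ((N : ℝ) - j)) - s * (k * D - j)
      = k * (((k : ℝ) * M - j - (M - m)) * ((k : ℝ) * M - j - (M - m) + 1))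
        + ((k : ℝ) * M - j) * (M * (k - 1) * (K - k) + (2 * m - l) * (K - k)) := by
    have e : s * (k * D - j) = k * (K * M * N - p * (p + 1)) - s * j := by rw [← hD]; ring
    rw [e, hs, hp, hN]; ring
  linarith

/-- Upper bound in the middle region. -/
lemma ub_mid (K M N B J : ℕ) (hK : 1 ≤ K) (hM : 1 ≤ M) (hN1 : 1 ≤ N) (E r s : ℝ) (hs : 0 < s)
    (hB1 : B < M) (hB2 : B < N) (hJ1 : J < K * M) (hJ2 : J < N)
    (hBr : (B : ℝ) ≤ r) (hrJ : K * r ≤ J)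
    (hB : s * (E - B) = ((M : ℝ) - B) * (N - B))
    (hJ : s * (K * E - J) = K * (((K : ℝ) * M - J) * (N - J)))
    (D : Fin K → ℝ) (hD : ∀ i, 0 ≤ D i ∧ D i ≤ (M : ℝ))
    (hL : (∑ i, D i) ≤ ((min N (K * M) : ℕ) : ℝ)) :
    ∃ A : Finset (Fin K), A.Nonempty ∧
      dIC (A.card * M) N (∑ a ∈ A, D a) ((A.card : ℝ) * r) ≤ s * (E - r) := by
  have hK' : (1 : ℝ) ≤ K := by exact_mod_cast hK
  have hB1' : (B : ℝ) < M := by exact_mod_cast hB1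
  have hB2' : (B : ℝ) < N := by exact_mod_cast hB2
  have hJ1' : (J : ℝ) < K * M := by exact_mod_cast hJ1
  have hJ2' : (J : ℝ) < N := by exact_mod_cast hJ2
  have hKE : 0 < K * E - J := by
    have : 0 < s * (K * E - J) := by
      rw [hJ]
      exact mul_pos (by linarith) (mul_pos (by linarith) (by linarith))
    exact (mul_pos_iff_of_pos_left hs).1 this
  have hEr : r < E := by
    have : K * r < K * E := by linarith
    exact lt_of_mul_lt_mul_left this (by linarith)
  have hLr : (∑ i, D i) ≤ N ∧ (∑ i, D i) ≤ K * M := by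
    push_cast at hL
    exact le_min_iff.1 hL
  have hr0 : 0 ≤ r := le_trans (Nat.cast_nonneg B) hBr
  by_cases hex : ∃ i, D i ≤ E
  · obtain ⟨i, hi⟩ := hex
    apply ub_single K M N i
    rcases le_or_gt (D i) r with h | h
    · rw [dIC, if_pos (Or.inr h)]
      exact mul_nonneg hs.le (by linarith)
    · have hDN : D i ≤ N := by
        refine le_trans ?_ hLr.1
        exact Finset.single_le_sum (fun j _ => (hD j).1) (Finset.mem_univ i)
      obtain ⟨σ, hσ0, hσ, hup, -⟩ := dIC_char M N hM hN1 (D i) (by linarith) (hD i).2 hDN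
      rw [hσ r h]
      have h1 := hup B
      rw [← hB] at h1
      -- σ (d - B) ≤ s (E - B), d ≤ E, B ≤ r < d
      have hdB : 0 < D i - B := by linarith
      have h2 : σ * (D i - r) * (D i - B) ≤ s * (E - r) * (D i - B) := by
        have e1 : σ * (D i - B) * (D i - r) ≤ s * (E - B) * (D i - r) :=
          mul_le_mul_of_nonneg_right h1 (by linarith)
        have e2 : 0 ≤ s * ((E - D i) * (r - B)) :=
          mul_nonneg hs.le (mul_nonneg (by linarith) (by linarith))
        nlinarith
      exact le_of_mul_le_mul_right h2 hdB
  · push Not at hex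
    apply ub_univ K M N hK
    have hsum : K * E ≤ ∑ i, D i := by
      have : ∑ _i : Fin K, E ≤ ∑ i, D i := Finset.sum_le_sum (fun i _ => (hex i).le)
      simpa using this
    generalize (∑ i, D i) = d at *
    have hKM : d ≤ ((K * M : ℕ) : ℝ) := by push_cast; exact hLr.2
    obtain ⟨σ, hσ0, hσ, hup, -⟩ := dIC_char (K * M) N (Nat.mul_pos hK hM) hN1 d
      (by have := (Nat.cast_nonneg J : (0 : ℝ) ≤ J); linarith) hKM hLr.1
    rw [hσ _ (by linarith)]
    have h1 := hup J
    push_cast at h1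
    have h1' : K * σ * (d - J) ≤ s * (K * E - J) := by
      rw [hJ, mul_assoc]; exact mul_le_mul_of_nonneg_left h1 (by linarith)
    have hdJ : 0 < d - J := by linarith
    have h2 : K * (σ * (d - K * r)) * (d - J) ≤ K * (s * (E - r)) * (d - J) := by
      have e1 := mul_le_mul_of_nonneg_right h1' (by linarith : 0 ≤ d - K * r)
      have e2 : 0 ≤ s * ((d - K * E) * (J - K * r)) :=
        mul_nonneg hs.le (mul_nonneg (by linarith) (by linarith))
      nlinarith
    exact le_of_mul_le_mul_left (le_of_mul_le_mul_right h2 hdJ) (by linarith)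

set_option maxHeartbeats 1000000 in
theorem stmt9 (K M : ℕ) (hK : 2 ≤ K) (hM : 2 ≤ M) (l : ℕ) (hl : l ≤ 2 * M - 3) :
    let N : ℕ := (K - 1) * M + 1 + l
    let L : ℕ := min N (K * M)
    let b : ℕ := l / 2
    let c : ℝ := (b : ℝ) * ((b : ℝ) + 1) + 2 * ((b : ℝ) + 1) * ((l : ℝ) / 2 - (b : ℝ))
    let S : ℝ → ℝ := fun r =>
      sSup {x : ℝ | ∃ D : Fin K → ℝ,
        (∀ i, 0 ≤ D i ∧ D i ≤ (M : ℝ)) ∧ (∑ i, D i) ≤ (L : ℝ) ∧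
        x = sInf {y : ℝ | ∃ A : Finset (Fin K), A.Nonempty ∧
              y = dIC (A.card * M) N (∑ a ∈ A, D a) ((A.card : ℝ) * r)}}
    (∀ r : ℝ, 0 ≤ r → r ≤ (b : ℝ) + 1 → S r = dFC M N r) ∧
    (∀ r : ℝ, (b : ℝ) + 1 ≤ r →
      r ≤ (((K - 1) * M + (l + 1) / 2 : ℕ) : ℝ) / (K : ℝ) →
      S r = (M : ℝ) * (N : ℝ) - c - ((N : ℝ) + (M : ℝ) - 1 - (l : ℝ)) * r) ∧
    (∀ r : ℝ, (((K - 1) * M + (l + 1) / 2 : ℕ) : ℝ) / (K : ℝ) ≤ r →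
      r ≤ (L : ℝ) / (K : ℝ) → S r = dFC (K * M) N ((K : ℝ) * r)) := by
  intro N L b c S
  have hK1 : 1 ≤ K := by omega
  have hM1 : 1 ≤ M := by omega
  have hN1 : 1 ≤ N := by show 1 ≤ (K - 1) * M + 1 + l; omega
  have hNr : (N : ℝ) = ((K : ℝ) - 1) * M + 1 + l := by
    show (((K - 1) * M + 1 + l : ℕ) : ℝ) = _
    push_cast [hK1]; ring
  have hKM : K * M = (K - 1) * M + M := by
    obtain ⟨q, rfl⟩ : ∃ q, K = q + 1 := ⟨K - 1, by omega⟩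
    simp; ring
  have hMle : M ≤ (K - 1) * M := Nat.le_mul_of_pos_left _ (by omega)
  have hNdef : N = (K - 1) * M + 1 + l := rfl
  have hbdef : b = l / 2 := rfl
  have hcdef : c = (b : ℝ) * ((b : ℝ) + 1) + 2 * ((b : ℝ) + 1) * ((l : ℝ) / 2 - (b : ℝ)) := rfl
  have hLdef : L = min N (K * M) := rfl
  have hSdef : ∀ r, S r = sSup {x : ℝ | ∃ D : Fin K → ℝ,
        (∀ i, 0 ≤ D i ∧ D i ≤ (M : ℝ)) ∧ (∑ i, D i) ≤ (L : ℝ) ∧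
        x = sInf {y : ℝ | ∃ A : Finset (Fin K), A.Nonempty ∧
              y = dIC (A.card * M) N (∑ a ∈ A, D a) ((A.card : ℝ) * r)}} := fun _ => rfl
  clear_value S c b L N
  have hKr : (2 : ℝ) ≤ K := by exact_mod_cast hK
  have hMr : (2 : ℝ) ≤ M := by exact_mod_cast hM
  have hbM : (b : ℝ) + 2 ≤ M := by
    have : b + 2 ≤ M := by omega
    exact_mod_cast this
  have hMN : (M : ℝ) + 1 ≤ N := by
    have : M + 1 ≤ N := by omega
    exact_mod_cast this
  have hNM0 : (0 : ℝ) < M * N := by apply mul_pos <;> linarith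
  have achA : ∀ (p : ℕ) (r : ℝ), p ≤ b → 0 ≤ r → ∃ D : Fin K → ℝ,
      (∀ i, 0 ≤ D i ∧ D i ≤ (M : ℝ)) ∧ (∑ i, D i) ≤ ((min N (K * M) : ℕ) : ℝ) ∧
      ∀ A : Finset (Fin K), A.Nonempty →
        (M : ℝ) * N - p * (p + 1) - (N + M - 1 - 2 * p) * r
          ≤ dIC (A.card * M) N (∑ a ∈ A, D a) ((A.card : ℝ) * r) := by
    intro p r hp h0
    have hpb : (p : ℝ) ≤ b := by exact_mod_cast hp
    have hp0 : (0 : ℝ) ≤ p := Nat.cast_nonneg p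
    have hs : (0 : ℝ) < N + M - 1 - 2 * p := by linarith
    have hsD : ((N : ℝ) + M - 1 - 2 * p) * ((M * N - p * (p + 1)) / (N + M - 1 - 2 * p))
      = M * N - p * (p + 1) := mul_div_cancel₀ _ hs.ne'
    refine ach K M N hK1 hM1 hN1 ((M * N - p * (p + 1)) / (N + M - 1 - 2 * p)) r
      (N + M - 1 - 2 * p) _ hs ?_ h0 ?_ (H_a K M N l p hNr (by omega) _ _ rfl hsD)
    · apply div_nonneg _ hs.le
      have : (p : ℝ) * (p + 1) ≤ M * N :=
        mul_le_mul (by linarith) (by linarith) (by linarith) (by positivity)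
      linarith
    · rw [mul_sub, hsD]
  refine ⟨?_, ?_, ?_⟩
  · intro r h0 hrb
    rw [hSdef, hLdef]
    apply S_eq
    · intro D hD hL
      apply ub_single K M N ⟨0, hK1⟩
      have hDN : D ⟨0, hK1⟩ ≤ N := by
        have := (hD ⟨0, hK1⟩).2
        linarith
      exact dIC_le_dFC M N hM1 hN1 _ r (hD _).2 hDN h0 (by linarith) (by linarith)
    · obtain ⟨p, hp, hp1, hp2⟩ : ∃ p : ℕ, p ≤ b ∧ (p : ℝ) ≤ r ∧ r ≤ p + 1 := by
        rcases hrb.lt_or_eq with h | h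
        · refine ⟨⌊r⌋₊, ?_, Nat.floor_le h0, (Nat.lt_floor_add_one r).le⟩
          have : ⌊r⌋₊ < b + 1 := by
            rw [Nat.floor_lt h0]; exact_mod_cast h
          omega
        · exact ⟨b, le_rfl, by linarith, h.le⟩
      rw [dFC_line M N p r hp1 hp2]
      exact achA p r hp h0
  · intro r hrb hrJ
    have hr0 : 0 ≤ r := by have := (Nat.cast_nonneg b : (0 : ℝ) ≤ b); linarith
    rw [hSdef, hLdef]
    have hs : (0 : ℝ) < K * M := by positivity
    rw [le_div_iff₀ (by linarith)] at hrJ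
    have hsD : ((K : ℝ) * M) * ((M * N - c) / (K * M)) = M * N - c := mul_div_cancel₀ _ hs.ne'
    set E : ℝ := (M * N - c) / (K * M) with hE
    have hUe : (M : ℝ) * N - c - (N + M - 1 - l) * r = K * M * (E - r) := by
      rw [mul_sub, hsD, hNr]; ring
    set J : ℕ := (K - 1) * M + (l + 1) / 2 with hJ
    have hJr : (J : ℝ) = ((K : ℝ) - 1) * M + ((l + 1) / 2 : ℕ) := by
      rw [hJ, Nat.cast_add, Nat.cast_mul, Nat.cast_sub hK1, Nat.cast_one]
    have hpar : (l = 2 * b ∧ (l + 1) / 2 = b) ∨ (l = 2 * b + 1 ∧ (l + 1) / 2 = b + 1) := by omega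
    apply S_eq
    · rw [hUe]
      refine ub_mid K M N (b + 1) J hK1 hM1 hN1 E r (K * M) hs (by omega) (by omega) (by omega)
        (by omega) (by push_cast; exact hrb) (by linarith) ?_ ?_
      · rw [mul_sub, hsD, hcdef]
        rcases hpar with ⟨h1, h2⟩ | ⟨h1, h2⟩
        · rw [hNr, h1]; push_cast; ring
        · rw [hNr, h1]; push_cast; ring
      · have e : (K : ℝ) * M * (K * E - J) = K * (M * N - c) - K * M * J := by
          rw [← hsD]; ring
        rw [e, hcdef, hJr]
        rcases hpar with ⟨h1, h2⟩ | ⟨h1, h2⟩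
        · rw [h2, hNr, h1]; push_cast; ring
        · rw [h2, hNr, h1]; push_cast; ring
    · rcases hpar with ⟨h1, h2⟩ | ⟨h1, h2⟩
      · have hlr : (l : ℝ) = 2 * b := by rw [h1]; push_cast; ring
        have hc : c = b * (b + 1) := by rw [hcdef, hlr]; ring
        have := achA b r le_rfl hr0
        rw [hc, hlr]
        exact this
      · have hlr : (l : ℝ) = 2 * b + 1 := by rw [h1]; push_cast; ring
        have hc : c = (b + 1) ^ 2 := by rw [hcdef, hlr]; ring
        have hE0 : 0 ≤ E := by
          apply div_nonneg _ hs.le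
          rw [hc]
          have hb0 := (Nat.cast_nonneg b : (0 : ℝ) ≤ b)
          have : ((b : ℝ) + 1) * (b + 1) ≤ M * N :=
            mul_le_mul (by linarith) (by linarith) (by linarith) (by positivity)
          linarith
        refine ach K M N hK1 hM1 hN1 E r (K * M) _ hs hE0 hr0 hUe
          (H_b K M N l b hNr h1 _ _ rfl ?_)
        rw [hsD, hc]
  · intro r hJr hrL
    rw [div_le_iff₀ (by linarith)] at hJr
    rw [le_div_iff₀ (by linarith)] at hrL
    have hJ0 : (0 : ℝ) ≤ (((K - 1) * M + (l + 1) / 2 : ℕ) : ℝ) := Nat.cast_nonneg _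
    have hKr0 : 0 ≤ K * r := by linarith
    have hr0 : 0 ≤ r := nonneg_of_mul_nonneg_right hKr0 (by linarith)
    have hLN : (L : ℝ) ≤ N := by
      have : L ≤ N := by omega
      exact_mod_cast this
    have hLKM : (L : ℝ) ≤ ((K * M : ℕ) : ℝ) := by
      have : L ≤ K * M := by omega
      exact_mod_cast this
    rw [hSdef]
    apply S_eq
    · intro D hD hL
      apply ub_univ K M N hK1
      exact dIC_le_dFC (K * M) N (by omega) hN1 _ _ (by linarith) (by linarith) hKr0
        (by linarith) (by linarith)
    · rcases hrL.eq_or_lt with h | h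
      · have h' : (K : ℝ) * r = (L : ℕ) := by linarith
        refine ⟨fun _ => 0, fun _ => ⟨le_rfl, by positivity⟩, by simp, ?_⟩
        intro A hA
        rw [dIC, if_pos (Or.inl (by simp)), h', dFC_nat]
        rcases le_total N (K * M) with hc | hc
        · rw [hLdef, min_eq_left hc]; simp
        · rw [hLdef, min_eq_right hc]; simp
      · have hp1 := Nat.floor_le hKr0
        have hp2 := Nat.lt_floor_add_one ((K : ℝ) * r)
        have hpJ : (K - 1) * M + (l + 1) / 2 ≤ ⌊(K : ℝ) * r⌋₊ := by
          apply Nat.le_floor; linarith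
        have hpL : ⌊(K : ℝ) * r⌋₊ < L := by
          rw [Nat.floor_lt hKr0]; linarith
        generalize ⌊(K : ℝ) * r⌋₊ = p at *
        rw [dFC_line (K * M) N p _ hp1 hp2.le, hLdef]
        obtain ⟨m, rfl⟩ : ∃ m, p = (K - 1) * M + m := ⟨p - (K - 1) * M, by omega⟩
        have hpr : (((K - 1) * M + m : ℕ) : ℝ) = ((K : ℝ) - 1) * M + m := by
          rw [Nat.cast_add, Nat.cast_mul, Nat.cast_sub hK1, Nat.cast_one]
        have hpN : (((K - 1) * M + m : ℕ) : ℝ) + 1 ≤ N := by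
          have : (K - 1) * M + m + 1 ≤ N := by omega
          exact_mod_cast this
        have hpM : (((K - 1) * M + m : ℕ) : ℝ) + 1 ≤ K * M := by
          have : (K - 1) * M + m + 1 ≤ K * M := by omega
          exact_mod_cast this
        have hm : l ≤ 2 * m := by omega
        generalize (K - 1) * M + m = p at *
        have hp0 : (0 : ℝ) ≤ p := Nat.cast_nonneg p
        have hs : (0 : ℝ) < K * (N + K * M - 1 - 2 * p) := by
          apply mul_pos <;> linarith
        have hsD := mul_div_cancel₀ ((K : ℝ) * M * N - p * (p + 1)) hs.ne'
        refine ach K M N hK1 hM1 hN1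
          ((K * M * N - p * (p + 1)) / (K * (N + K * M - 1 - 2 * p))) r
          (K * (N + K * M - 1 - 2 * p)) _ hs ?_ hr0 ?_
          (H_c K M N l m p hNr hm hpr _ _ rfl hsD)
        · apply div_nonneg _ hs.le
          have : (p : ℝ) * (p + 1) ≤ K * M * N :=
            mul_le_mul (by linarith) hpN (by linarith) (by positivity)
          linarith
        · rw [mul_sub, hsD]; push_cast; ring
end
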